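/- arXiv:1402.3527 — 4 statements merged into one kernel-verified Lean document; each statement's English description precedes it below -/
import Mathlib

section
/- Let d ≥ 1, let ρ : ℝ × ℝ^d → ℝ and u, ū, u' : ℝ × ℝ^d → ℝ^d be smooth with u = ū + u', and assume at every point: the continuity equation ∂_t ρ + div(ρ u) = 0, together with the base-flow properties div ū = 0, ∂_t ū + (ū·∇)ū = 0, (u'·∇)ū = 0, and Σ_{i,j}(∂_{x_i} ū_j)(∂_{x_j} ū_i) = 0. Then at every point (∂_t + ū·∇)((∂_t + ū·∇) ρ) = ∂_t² ρ − Σ_{i,j} ∂_{x_i} ∂_{x_j} ( ρ u_i u_j − ρ u'_i u'_j ). -/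
/-- Time derivative `∂_t f` of a function of time and space. -/
noncomputable def dt {d : ℕ} (f : ℝ × (Fin d → ℝ) → ℝ) (z : ℝ × (Fin d → ℝ)) : ℝ :=
  fderiv ℝ f z (1, 0)

/-- Spatial derivative `∂_{x_i} f` of a function of time and space. -/
noncomputable def dx {d : ℕ} (i : Fin d) (f : ℝ × (Fin d → ℝ) → ℝ) (z : ℝ × (Fin d → ℝ)) : ℝ :=
  fderiv ℝ f z (0, Pi.single i 1)

section DirectionalDerivative

variable {E : Type*} [NormedAddCommGroup E] [NormedSpace ℝ E] {f g : E → ℝ}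

theorem fderiv_mul_apply_of_smooth (hf : ContDiff ℝ (⊤ : ℕ∞) f) (hg : ContDiff ℝ (⊤ : ℕ∞) g)
    (z v : E) :
    fderiv ℝ (fun w => f w * g w) z v = fderiv ℝ f z v * g z + f z * fderiv ℝ g z v := by
  rw [fderiv_fun_mul (hf.differentiable (by simp) z) (hg.differentiable (by simp) z)]
  simp only [add_apply, smul_apply, smul_eq_mul]
  ring

theorem contDiff_fderiv_apply_const (hf : ContDiff ℝ (⊤ : ℕ∞) f) (v : E) :
    ContDiff ℝ (⊤ : ℕ∞) (fun z => fderiv ℝ f z v) :=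
  (hf.fderiv_right (by simp)).clm_apply contDiff_const

theorem fderiv_fderiv_apply_comm (hf : ContDiff ℝ (⊤ : ℕ∞) f) (z v w : E) :
    fderiv ℝ (fun y => fderiv ℝ f y v) z w = fderiv ℝ (fun y => fderiv ℝ f y w) z v := by
  have hd : DifferentiableAt ℝ (fderiv ℝ f) z :=
    (hf.fderiv_right (m := (⊤ : ℕ∞)) (by simp)).differentiable (by simp) z
  have hs : IsSymmSndFDerivAt ℝ f z :=
    hf.contDiffAt.isSymmSndFDerivAt (by simpa using WithTop.coe_le_coe.2 (le_top (a := (2 : ℕ∞))))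
  rw [fderiv_clm_apply hd (by fun_prop), fderiv_clm_apply hd (by fun_prop)]
  simpa using hs w v

theorem fderiv_sum_apply_of_smooth {ι : Type*} [Fintype ι] {F : ι → E → ℝ}
    (hF : ∀ i, ContDiff ℝ (⊤ : ℕ∞) (F i)) (z v : E) :
    fderiv ℝ (fun w => ∑ i, F i w) z v = ∑ i, fderiv ℝ (F i) z v := by
  rw [fderiv_fun_sum fun i _ => (hF i).differentiable (by simp) z]
  simp

end DirectionalDerivative

section SpaceTime

variable {d : ℕ} {f g : ℝ × (Fin d → ℝ) → ℝ}

theorem contDiff_dt (hf : ContDiff ℝ (⊤ : ℕ∞) f) : ContDiff ℝ (⊤ : ℕ∞) (dt f) :=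
  contDiff_fderiv_apply_const hf _

theorem contDiff_dx (hf : ContDiff ℝ (⊤ : ℕ∞) f) (i : Fin d) : ContDiff ℝ (⊤ : ℕ∞) (dx i f) :=
  contDiff_fderiv_apply_const hf _

theorem dt_mul (hf : ContDiff ℝ (⊤ : ℕ∞) f) (hg : ContDiff ℝ (⊤ : ℕ∞) g)
    (z : ℝ × (Fin d → ℝ)) :
    dt (fun w => f w * g w) z = dt f z * g z + f z * dt g z :=
  fderiv_mul_apply_of_smooth hf hg z _

theorem dx_mul (hf : ContDiff ℝ (⊤ : ℕ∞) f) (hg : ContDiff ℝ (⊤ : ℕ∞) g) (i : Fin d)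
    (z : ℝ × (Fin d → ℝ)) :
    dx i (fun w => f w * g w) z = dx i f z * g z + f z * dx i g z :=
  fderiv_mul_apply_of_smooth hf hg z _

theorem dt_add (hf : ContDiff ℝ (⊤ : ℕ∞) f) (hg : ContDiff ℝ (⊤ : ℕ∞) g)
    (z : ℝ × (Fin d → ℝ)) : dt (fun w => f w + g w) z = dt f z + dt g z := by
  simp only [dt]
  rw [fderiv_fun_add (hf.differentiable (by simp) z) (hg.differentiable (by simp) z)]
  rfl

theorem dx_add (hf : ContDiff ℝ (⊤ : ℕ∞) f) (hg : ContDiff ℝ (⊤ : ℕ∞) g) (i : Fin d)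
    (z : ℝ × (Fin d → ℝ)) : dx i (fun w => f w + g w) z = dx i f z + dx i g z := by
  simp only [dx]
  rw [fderiv_fun_add (hf.differentiable (by simp) z) (hg.differentiable (by simp) z)]
  rfl

theorem dx_sub (hf : ContDiff ℝ (⊤ : ℕ∞) f) (hg : ContDiff ℝ (⊤ : ℕ∞) g) (i : Fin d)
    (z : ℝ × (Fin d → ℝ)) : dx i (fun w => f w - g w) z = dx i f z - dx i g z := by
  simp only [dx]
  rw [fderiv_fun_sub (hf.differentiable (by simp) z) (hg.differentiable (by simp) z)]
  rfl

theorem dx_neg (i : Fin d) (z : ℝ × (Fin d → ℝ)) : dx i (fun w => -f w) z = -dx i f z := by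
  simp only [dx]
  rw [fderiv_fun_neg]
  rfl

theorem dt_sum {ι : Type*} [Fintype ι] {F : ι → ℝ × (Fin d → ℝ) → ℝ}
    (hF : ∀ k, ContDiff ℝ (⊤ : ℕ∞) (F k)) (z : ℝ × (Fin d → ℝ)) :
    dt (fun w => ∑ k, F k w) z = ∑ k, dt (F k) z :=
  fderiv_sum_apply_of_smooth hF z _

theorem dx_sum {ι : Type*} [Fintype ι] {F : ι → ℝ × (Fin d → ℝ) → ℝ}
    (hF : ∀ k, ContDiff ℝ (⊤ : ℕ∞) (F k)) (i : Fin d) (z : ℝ × (Fin d → ℝ)) :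
    dx i (fun w => ∑ k, F k w) z = ∑ k, dx i (F k) z :=
  fderiv_sum_apply_of_smooth hF z _

theorem dx_dx_comm (hf : ContDiff ℝ (⊤ : ℕ∞) f) (i j : Fin d) (z : ℝ × (Fin d → ℝ)) :
    dx i (dx j f) z = dx j (dx i f) z :=
  fderiv_fderiv_apply_comm hf z _ _

theorem dx_dt_comm (hf : ContDiff ℝ (⊤ : ℕ∞) f) (i : Fin d) (z : ℝ × (Fin d → ℝ)) :
    dx i (dt f) z = dt (dx i f) z :=
  fderiv_fderiv_apply_comm hf z _ _

/-- The divergence of `f v`. -/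
theorem sum_dx_mul {v : ℝ × (Fin d → ℝ) → Fin d → ℝ} (hf : ContDiff ℝ (⊤ : ℕ∞) f)
    (hv : ∀ i, ContDiff ℝ (⊤ : ℕ∞) (fun w => v w i)) (z : ℝ × (Fin d → ℝ)) :
    ∑ i, dx i (fun w => f w * v w i) z
      = ∑ i, v z i * dx i f z + f z * ∑ i, dx i (fun w => v w i) z := by
  rw [Finset.mul_sum, ← Finset.sum_add_distrib]
  refine Finset.sum_congr rfl fun i _ => ?_
  rw [dx_mul hf (hv i)]
  ring

end SpaceTime

/-- with `u = ū + u'`, the continuity equation, `div ū = 0`,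
`∂_t ū + (ū·∇)ū = 0`, `(u'·∇)ū = 0` and `∑_{i,j}(∂_{x_i} ū_j)(∂_{x_j} ū_i) = 0`, we have
`(∂_t + ū·∇)((∂_t + ū·∇) ρ) = ∂_t² ρ − ∑_{i,j} ∂_{x_i}∂_{x_j}(ρ u_i u_j − ρ u'_i u'_j)`. -/
theorem stmt12 (d : ℕ) (hd : 1 ≤ d)
    (ρf : ℝ × (Fin d → ℝ) → ℝ) (u ub u' : ℝ × (Fin d → ℝ) → Fin d → ℝ)
    (hρ : ContDiff ℝ (⊤ : ℕ∞) ρf) (hu : ContDiff ℝ (⊤ : ℕ∞) u) (hub : ContDiff ℝ (⊤ : ℕ∞) ub)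
    (hu'c : ContDiff ℝ (⊤ : ℕ∞) u')
    (hsum : ∀ z, u z = ub z + u' z)
    (hcont : ∀ z, dt ρf z + ∑ i, dx i (fun w => ρf w * u w i) z = 0)
    (hdivub : ∀ z, ∑ i, dx i (fun w => ub w i) z = 0)
    (hpath : ∀ z, ∀ j : Fin d, dt (fun w => ub w j) z
        + ∑ i, ub z i * dx i (fun w => ub w j) z = 0)
    (hperp : ∀ z, ∀ j : Fin d, ∑ i, u' z i * dx i (fun w => ub w j) z = 0)
    (hgrad : ∀ z, ∑ i, ∑ j, dx i (fun w => ub w j) z * dx j (fun w => ub w i) z = 0) :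
    ∀ z, dt (fun w => dt ρf w + ∑ i, ub w i * dx i ρf w) z
        + ∑ i, ub z i * dx i (fun w => dt ρf w + ∑ j, ub w j * dx j ρf w) z
      = dt (dt ρf) z - ∑ i, ∑ j, dx i (fun w => dx j (fun v =>
          ρf v * u v i * u v j - ρf v * u' v i * u' v j) w) z := by
  intro z
  have hui := contDiff_pi.1 hu
  have hubi := contDiff_pi.1 hub
  have hρi := contDiff_dx hρ
  have hρt := contDiff_dt hρ
  set m : ℝ × (Fin d → ℝ) → ℝ := fun w => ∑ i, ub w i * dx i ρf w with hm
  have hmS : ContDiff ℝ (⊤ : ℕ∞) m := ContDiff.sum fun i _ => (hubi i).mul (hρi i)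
  have hdivρ : ∀ w, ∑ i, dx i (fun v => ρf v * ub v i) w = m w := fun w => by
    rw [sum_dx_mul hρ hubi, hdivub, mul_zero, add_zero]
  have hGS : ∀ i j, ContDiff ℝ (⊤ : ℕ∞) (fun v => ρf v * u v i * ub v j) := fun i j =>
    (hρ.mul (hui i)).mul (hubi j)
  have hHS : ∀ i j, ContDiff ℝ (⊤ : ℕ∞) (fun v => ρf v * ub v i * ub v j) := fun i j =>
    (hρ.mul (hubi i)).mul (hubi j)
  have hG : ∀ w j, ∑ i, dx i (fun v => ρf v * u v i * ub v j) w
      = -dt (fun v => ρf v * ub v j) w := fun w j => by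
    have hadv : ∑ i, u w i * dx i (fun v => ub v j) w = -dt (fun v => ub v j) w := by
      simp only [hsum, Pi.add_apply, add_mul, Finset.sum_add_distrib, hperp w j]
      linarith [hpath w j]
    have hprod : ∑ i, dx i (fun v => ρf v * u v i * ub v j) w
        = (∑ i, dx i (fun v => ρf v * u v i) w) * ub w j
          + ρf w * ∑ i, u w i * dx i (fun v => ub v j) w := by
      rw [Finset.sum_mul, Finset.mul_sum, ← Finset.sum_add_distrib]
      refine Finset.sum_congr rfl fun i _ => ?_
      rw [dx_mul (hρ.mul (hui i)) (hubi j)]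
      ring
    rw [hprod, hadv, dt_mul hρ (hubi j)]
    linear_combination ub w j * hcont w
  have hH : ∀ w i, ∑ j, dx j (fun v => ρf v * ub v i * ub v j) w
      = m w * ub w i - ρf w * dt (fun v => ub v i) w := fun w i => by
    rw [sum_dx_mul (hρ.mul (hubi i)) hubi, hdivub, mul_zero, add_zero]
    have hprod : ∑ j, ub w j * dx j (fun v => ρf v * ub v i) w
        = m w * ub w i + ρf w * ∑ j, ub w j * dx j (fun v => ub v i) w := by
      rw [hm, Finset.sum_mul, Finset.mul_sum, ← Finset.sum_add_distrib]
      refine Finset.sum_congr rfl fun j _ => ?_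
      rw [dx_mul hρ (hubi i)]
      ring
    rw [hprod]
    linear_combination ρf w * hpath w i
  have hGG : ∑ i, dx i (fun w => ∑ j, dx j (fun v => ρf v * u v j * ub v i) w) z = -dt m z := by
    simp only [hG, dx_neg, Finset.sum_neg_distrib]
    rw [show m = fun w => ∑ i, dx i (fun v => ρf v * ub v i) w from funext fun w => (hdivρ w).symm,
      dt_sum fun i => contDiff_dx (hρ.mul (hubi i)) i]
    exact congrArg _ (Finset.sum_congr rfl fun i _ => dx_dt_comm (hρ.mul (hubi i)) i z)
  have hdivt : ∑ i, dx i (fun w => dt (fun v => ub v i) w) z = 0 := by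
    have h0 : (fun w => ∑ i, dx i (fun v => ub v i) w) = fun _ => 0 := funext hdivub
    have h1 : dt (fun w => ∑ i, dx i (fun v => ub v i) w) z = 0 := by simp [h0, dt]
    rw [dt_sum fun i => contDiff_dx (hubi i) i] at h1
    rw [← h1]
    exact Finset.sum_congr rfl fun i _ => dx_dt_comm (hubi i) i z
  have hHH : ∑ i, dx i (fun w => ∑ j, dx j (fun v => ρf v * ub v i * ub v j) w) z
      = ∑ i, ub z i * dx i m z - ∑ i, dt (fun v => ub v i) z * dx i ρf z := by
    have hs : ∀ i, dx i (fun w => m w * ub w i - ρf w * dt (fun v => ub v i) w) z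
        = dx i (fun w => m w * ub w i) z - dx i (fun w => ρf w * dt (fun v => ub v i) w) z :=
      fun i => dx_sub (hmS.mul (hubi i)) (hρ.mul (contDiff_dt (hubi i))) i z
    simp only [hH, hs, Finset.sum_sub_distrib]
    rw [sum_dx_mul hmS hubi,
      sum_dx_mul (v := fun w i => dt (fun v => ub v i) w) hρ fun i => contDiff_dt (hubi i),
      hdivub, hdivt]
    ring
  have hflux : ∑ i, ∑ j, dx i (fun w => dx j (fun v =>
        ρf v * u v i * u v j - ρf v * u' v i * u' v j) w) z
      = ∑ i, ∑ j, dx i (dx j (fun v => ρf v * u v i * ub v j)) z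
        + ∑ i, ∑ j, dx i (dx j (fun v => ρf v * u v j * ub v i)) z
        - ∑ i, ∑ j, dx i (dx j (fun v => ρf v * ub v i * ub v j)) z := by
    simp only [← Finset.sum_add_distrib, ← Finset.sum_sub_distrib]
    refine Finset.sum_congr rfl fun i _ => Finset.sum_congr rfl fun j _ => ?_
    have hF : (fun v => ρf v * u v i * u v j - ρf v * u' v i * u' v j)
        = fun v => ρf v * u v i * ub v j + ρf v * u v j * ub v i - ρf v * ub v i * ub v j := by
      funext v
      simp only [hsum, Pi.add_apply]
      ring
    simp only [hF, dx_sub ((hGS i j).add (hGS j i)) (hHS i j), dx_add (hGS i j) (hGS j i)]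
    rw [dx_sub ((contDiff_dx (hGS i j) j).add (contDiff_dx (hGS j i) j)) (contDiff_dx (hHS i j) j),
      dx_add (contDiff_dx (hGS i j) j) (contDiff_dx (hGS j i) j)]
  have hsymm : ∑ i, ∑ j, dx i (dx j (fun v => ρf v * u v i * ub v j)) z
      = ∑ i, ∑ j, dx i (dx j (fun v => ρf v * u v j * ub v i)) z := by
    rw [Finset.sum_comm]
    exact Finset.sum_congr rfl fun i _ => Finset.sum_congr rfl fun j _ => dx_dx_comm (hGS j i) j i z
  have hGsum : ∑ i, ∑ j, dx i (dx j (fun v => ρf v * u v j * ub v i)) z = -dt m z := by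
    rw [← hGG]
    exact Finset.sum_congr rfl fun i _ => (dx_sum (fun j => contDiff_dx (hGS j i) j) i z).symm
  have hHsum : ∑ i, ∑ j, dx i (dx j (fun v => ρf v * ub v i * ub v j)) z
      = ∑ i, ub z i * dx i m z - ∑ i, dt (fun v => ub v i) z * dx i ρf z := by
    rw [← hHH]
    exact Finset.sum_congr rfl fun i _ => (dx_sum (fun j => contDiff_dx (hHS i j) j) i z).symm
  have hmt : dt m z = ∑ i, dt (fun v => ub v i) z * dx i ρf z
      + ∑ i, ub z i * dx i (dt ρf) z := by
    rw [hm, dt_sum fun i => (hubi i).mul (hρi i), ← Finset.sum_add_distrib]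
    refine Finset.sum_congr rfl fun i _ => ?_
    rw [dt_mul (hubi i) (hρi i), dx_dt_comm hρ]
  have hlt : dt (fun w => dt ρf w + m w) z = dt (dt ρf) z + dt m z := dt_add hρt hmS z
  have hlx : ∑ i, ub z i * dx i (fun w => dt ρf w + m w) z
      = ∑ i, ub z i * dx i (dt ρf) z + ∑ i, ub z i * dx i m z := by
    simp only [dx_add hρt hmS, mul_add, Finset.sum_add_distrib]
  rw [hflux, hsymm, hGsum, hHsum]
  change dt (fun w => dt ρf w + m w) z + ∑ i, ub z i * dx i (fun w => dt ρf w + m w) z = _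
  rw [hlt, hlx]
  linear_combination -hmt
end

section
/- Let d ≥ 1, let c > 0 and ρ̄ > 0 be constants, and let ρ, p, p' : ℝ × ℝ^d → ℝ and u, ū, u' : ℝ × ℝ^d → ℝ^d be smooth with u = ū + u', ρ = ρ̄ + p'/c², and p − c² ρ constant. Assume at every point: the continuity equation ∂_t ρ + div(ρ u) = 0, the inviscid momentum equation ρ(∂_t u + (u·∇)u) + ∇p = 0, div ū = 0, ∂_t ū + (ū·∇)ū = 0, (u'·∇)ū = 0, and Σ_{i,j}(∂_{x_i} ū_j)(∂_{x_j} ū_i) = 0. Then at every point the exact convective Lighthill equation (1/c²)(∂_t + ū·∇)((∂_t + ū·∇) p') − Δ p' = Σ_{i,j} ∂_{x_i} ∂_{x_j} ( ρ u'_i u'_j ) holds. -/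
section DirDeriv

variable {E : Type*} [NormedAddCommGroup E] [NormedSpace ℝ E]

/-- Derivative of a scalar function in the fixed direction `v`. -/
noncomputable def dirDeriv (v : E) (f : E → ℝ) (z : E) : ℝ := fderiv ℝ f z v

theorem contDiff_dirDeriv (v : E) {f : E → ℝ} (hf : ContDiff ℝ (⊤ : ℕ∞) f) :
    ContDiff ℝ (⊤ : ℕ∞) (dirDeriv v f) :=
  (hf.fderiv_right (m := (⊤ : ℕ∞)) (by norm_cast)).clm_apply contDiff_const

theorem dirDeriv_add (v : E) {f g : E → ℝ} (hf : ContDiff ℝ (⊤ : ℕ∞) f)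
    (hg : ContDiff ℝ (⊤ : ℕ∞) g) (z : E) :
    dirDeriv v (fun w => f w + g w) z = dirDeriv v f z + dirDeriv v g z := by
  unfold dirDeriv
  rw [fderiv_fun_add (hf.differentiable (by simp) z) (hg.differentiable (by simp) z)]
  rfl

theorem dirDeriv_mul (v : E) {f g : E → ℝ} (hf : ContDiff ℝ (⊤ : ℕ∞) f)
    (hg : ContDiff ℝ (⊤ : ℕ∞) g) (z : E) :
    dirDeriv v (fun w => f w * g w) z = f z * dirDeriv v g z + g z * dirDeriv v f z := by
  unfold dirDeriv
  rw [fderiv_fun_mul (hf.differentiable (by simp) z) (hg.differentiable (by simp) z)]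
  simp

theorem dirDeriv_sum {ι : Type*} [Fintype ι] (v : E) {f : ι → E → ℝ}
    (hf : ∀ i, ContDiff ℝ (⊤ : ℕ∞) (f i)) (z : E) :
    dirDeriv v (fun w => ∑ i, f i w) z = ∑ i, dirDeriv v (f i) z := by
  unfold dirDeriv
  rw [fderiv_fun_sum fun i _ => (hf i).differentiable (by simp) z]
  simp

theorem dirDeriv_const (v : E) (a : ℝ) (z : E) : dirDeriv v (fun _ => a) z = 0 := by
  simp [dirDeriv]

theorem dirDeriv_const_mul (v : E) (a : ℝ) {f : E → ℝ} (hf : ContDiff ℝ (⊤ : ℕ∞) f) (z : E) :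
    dirDeriv v (fun w => a * f w) z = a * dirDeriv v f z := by
  rw [dirDeriv_mul v contDiff_const hf, dirDeriv_const]
  ring

theorem dirDeriv_comm (v w : E) {f : E → ℝ} (hf : ContDiff ℝ (⊤ : ℕ∞) f) (z : E) :
    dirDeriv v (dirDeriv w f) z = dirDeriv w (dirDeriv v f) z := by
  have hd : DifferentiableAt ℝ (fderiv ℝ f) z :=
    (hf.fderiv_right (m := (⊤ : ℕ∞)) (by norm_cast)).differentiable (by simp) z
  have key (a b : E) : dirDeriv a (dirDeriv b f) z = fderiv ℝ (fderiv ℝ f) z a b := by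
    unfold dirDeriv
    rw [fderiv_clm_apply hd (differentiableAt_const b)]
    simp
  rw [key, key]
  exact (contDiff_infty.1 hf 2).contDiffAt.isSymmSndFDerivAt (by simp) v w

variable {ι : Type*} [Fintype ι]

/-- The derivative `∂_T + ∑ i, U i ∂_{e i}` along the flow with velocity components `U i`. -/
noncomputable def convDeriv (T : E) (e : ι → E) (U : ι → E → ℝ) (f : E → ℝ) (z : E) : ℝ :=
  dirDeriv T f z + ∑ i, U i z * dirDeriv (e i) f z

variable (T : E) (e : ι → E) {U : ι → E → ℝ}

theorem contDiff_convDeriv (hU : ∀ i, ContDiff ℝ (⊤ : ℕ∞) (U i)) {f : E → ℝ}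
    (hf : ContDiff ℝ (⊤ : ℕ∞) f) : ContDiff ℝ (⊤ : ℕ∞) (convDeriv T e U f) :=
  (contDiff_dirDeriv T hf).add
    (ContDiff.sum fun i _ => (hU i).mul (contDiff_dirDeriv (e i) hf))

theorem convDeriv_add {f g : E → ℝ} (hf : ContDiff ℝ (⊤ : ℕ∞) f)
    (hg : ContDiff ℝ (⊤ : ℕ∞) g) (z : E) :
    convDeriv T e U (fun w => f w + g w) z = convDeriv T e U f z + convDeriv T e U g z := by
  simp only [convDeriv, dirDeriv_add _ hf hg, mul_add, Finset.sum_add_distrib]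
  ring

theorem convDeriv_mul {f g : E → ℝ} (hf : ContDiff ℝ (⊤ : ℕ∞) f)
    (hg : ContDiff ℝ (⊤ : ℕ∞) g) (z : E) :
    convDeriv T e U (fun w => f w * g w) z
      = f z * convDeriv T e U g z + g z * convDeriv T e U f z := by
  simp only [convDeriv, dirDeriv_mul _ hf hg, mul_add, Finset.sum_add_distrib, Finset.mul_sum,
    mul_left_comm]
  ring

theorem convDeriv_const (a : ℝ) (z : E) : convDeriv T e U (fun _ => a) z = 0 := by
  simp [convDeriv, dirDeriv_const]

theorem convDeriv_const_mul (a : ℝ) {f : E → ℝ} (hf : ContDiff ℝ (⊤ : ℕ∞) f) (z : E) :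
    convDeriv T e U (fun w => a * f w) z = a * convDeriv T e U f z := by
  rw [convDeriv_mul T e contDiff_const hf, convDeriv_const]
  ring

theorem convDeriv_sum {κ : Type*} [Fintype κ] {f : κ → E → ℝ}
    (hf : ∀ k, ContDiff ℝ (⊤ : ℕ∞) (f k)) (z : E) :
    convDeriv T e U (fun w => ∑ k, f k w) z = ∑ k, convDeriv T e U (f k) z := by
  simp only [convDeriv, dirDeriv_sum _ hf, Finset.mul_sum, Finset.sum_add_distrib]
  rw [Finset.sum_comm]

theorem dirDeriv_convDeriv (hU : ∀ i, ContDiff ℝ (⊤ : ℕ∞) (U i)) (v : E) {f : E → ℝ}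
    (hf : ContDiff ℝ (⊤ : ℕ∞) f) (z : E) :
    dirDeriv v (convDeriv T e U f) z
      = convDeriv T e U (dirDeriv v f) z + ∑ i, dirDeriv v (U i) z * dirDeriv (e i) f z := by
  have hs (i : ι) : ContDiff ℝ (⊤ : ℕ∞) fun w => U i w * dirDeriv (e i) f w :=
    (hU i).mul (contDiff_dirDeriv _ hf)
  have h : dirDeriv v (convDeriv T e U f) z
      = dirDeriv v (dirDeriv T f) z + dirDeriv v (fun w => ∑ i, U i w * dirDeriv (e i) f w) z :=
    dirDeriv_add v (contDiff_dirDeriv T hf) (ContDiff.sum fun i _ => hs i) z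
  rw [h, dirDeriv_sum v hs, convDeriv, dirDeriv_comm v T hf, add_assoc,
    ← Finset.sum_add_distrib]
  congr 1
  refine Finset.sum_congr rfl fun i _ => ?_
  rw [dirDeriv_mul v (hU i) (contDiff_dirDeriv _ hf), dirDeriv_comm v (e i) hf]
  ring

/-- If `div U = 0` and `(m·∇)U = 0` then `∑ i j, (∂_j U_i)(∂_i m_j) = 0`. -/
theorem sum_dirDeriv_mul_dirDeriv_eq_zero {m : ι → E → ℝ}
    (hU : ∀ i, ContDiff ℝ (⊤ : ℕ∞) (U i)) (hm : ∀ i, ContDiff ℝ (⊤ : ℕ∞) (m i))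
    (hdiv : ∀ z, ∑ i, dirDeriv (e i) (U i) z = 0)
    (hperp : ∀ z i, ∑ j, m j z * dirDeriv (e j) (U i) z = 0) (z : E) :
    ∑ j, ∑ i, dirDeriv (e j) (U i) z * dirDeriv (e i) (m j) z = 0 := by
  have h₁ (i : ι) : ∑ j, (m j z * dirDeriv (e i) (dirDeriv (e j) (U i)) z
      + dirDeriv (e j) (U i) z * dirDeriv (e i) (m j) z) = 0 := by
    have h : dirDeriv (e i) (fun w => ∑ j, m j w * dirDeriv (e j) (U i) w) z = 0 := by
      simp only [hperp, dirDeriv_const]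
    rw [dirDeriv_sum _ fun j => (hm j).mul (contDiff_dirDeriv _ (hU i))] at h
    simpa only [dirDeriv_mul _ (hm _) (contDiff_dirDeriv _ (hU i))] using h
  have h₂ (j : ι) : ∑ i, m j z * dirDeriv (e i) (dirDeriv (e j) (U i)) z = 0 := by
    have h : dirDeriv (e j) (fun w => ∑ i, dirDeriv (e i) (U i) w) z = 0 := by
      simp only [hdiv, dirDeriv_const]
    rw [dirDeriv_sum _ fun i => contDiff_dirDeriv _ (hU i)] at h
    simp only [dirDeriv_comm (e j) _ (hU _)] at h
    rw [← Finset.mul_sum, h, mul_zero]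
  have h₃ := Finset.sum_eq_zero fun i (_ : i ∈ Finset.univ) => h₁ i
  rw [Finset.sum_comm] at h₃
  simpa only [Finset.sum_add_distrib, h₂, Finset.sum_const_zero, zero_add] using h₃

/-- If `div U = 0`, `(m·∇)U = 0`, `D m_j + ∑ i, ∂_i S_{ij} + ∂_j q = 0` with `D` the derivative
along `U`, then `D (div m) + ∑ i j, ∂_j ∂_i S_{ij} + Δ q = 0`. -/
theorem convDeriv_div_add_eq_zero {m : ι → E → ℝ} {S : ι → ι → E → ℝ} {q : E → ℝ}
    (hU : ∀ i, ContDiff ℝ (⊤ : ℕ∞) (U i)) (hm : ∀ i, ContDiff ℝ (⊤ : ℕ∞) (m i))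
    (hS : ∀ i j, ContDiff ℝ (⊤ : ℕ∞) (S i j)) (hq : ContDiff ℝ (⊤ : ℕ∞) q)
    (hdiv : ∀ z, ∑ i, dirDeriv (e i) (U i) z = 0)
    (hperp : ∀ z i, ∑ j, m j z * dirDeriv (e j) (U i) z = 0)
    (hmom : ∀ z j, convDeriv T e U (m j) z + ∑ i, dirDeriv (e i) (S i j) z
      + dirDeriv (e j) q z = 0) (z : E) :
    convDeriv T e U (fun w => ∑ j, dirDeriv (e j) (m j) w) z
      + ∑ j, ∑ i, dirDeriv (e j) (dirDeriv (e i) (S i j)) z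
      + ∑ j, dirDeriv (e j) (dirDeriv (e j) q) z = 0 := by
  have h (j : ι) : convDeriv T e U (dirDeriv (e j) (m j)) z
      + ∑ i, dirDeriv (e j) (U i) z * dirDeriv (e i) (m j) z
      + ∑ i, dirDeriv (e j) (dirDeriv (e i) (S i j)) z
      + dirDeriv (e j) (dirDeriv (e j) q) z = 0 := by
    have hSj (i : ι) := contDiff_dirDeriv (e i) (hS i j)
    have hDm := contDiff_convDeriv T e hU (hm j)
    have hsum : ContDiff ℝ (⊤ : ℕ∞) fun w => ∑ i, dirDeriv (e i) (S i j) w :=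
      ContDiff.sum fun i _ => hSj i
    have h0 : dirDeriv (e j) (fun w => convDeriv T e U (m j) w
        + ∑ i, dirDeriv (e i) (S i j) w + dirDeriv (e j) q w) z = 0 := by
      simp only [hmom, dirDeriv_const]
    rwa [dirDeriv_add _ (hDm.add hsum) (contDiff_dirDeriv _ hq), dirDeriv_add _ hDm hsum,
      dirDeriv_sum _ hSj, dirDeriv_convDeriv T e hU _ (hm j)] at h0
  have h' := Finset.sum_eq_zero fun j (_ : j ∈ Finset.univ) => h j
  simp only [Finset.sum_add_distrib] at h'
  rwa [sum_dirDeriv_mul_dirDeriv_eq_zero e hU hm hdiv hperp, add_zero,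
    ← convDeriv_sum T e fun j => contDiff_dirDeriv (e j) (hm j)] at h'

end DirDeriv


/-- exact convective Lighthill equation. With `u = ū + u'`,
`ρ = ρ̄ + p'/c²`, `p − c² ρ` constant, the continuity and inviscid momentum equations, and
the base-flow properties `div ū = 0`, `∂_t ū + (ū·∇)ū = 0`, `(u'·∇)ū = 0`,
`∑_{i,j}(∂_{x_i} ū_j)(∂_{x_j} ū_i) = 0`, one has
`(1/c²)(∂_t + ū·∇)((∂_t + ū·∇) p') − Δ p' = ∑_{i,j} ∂_{x_i}∂_{x_j}(ρ u'_i u'_j)`. -/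
theorem stmt13 (d : ℕ) (hd : 1 ≤ d) (c ρb : ℝ) (hc : 0 < c) (hρb : 0 < ρb)
    (ρf pf p' : ℝ × (Fin d → ℝ) → ℝ) (u ub u' : ℝ × (Fin d → ℝ) → Fin d → ℝ)
    (hρ : ContDiff ℝ (⊤ : ℕ∞) ρf) (hp : ContDiff ℝ (⊤ : ℕ∞) pf) (hp' : ContDiff ℝ (⊤ : ℕ∞) p')
    (hu : ContDiff ℝ (⊤ : ℕ∞) u) (hub : ContDiff ℝ (⊤ : ℕ∞) ub) (hu'c : ContDiff ℝ (⊤ : ℕ∞) u')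
    (hsum : ∀ z, u z = ub z + u' z)
    (hρdef : ∀ z, ρf z = ρb + p' z / c ^ 2)
    (hpconst : ∃ k : ℝ, ∀ z, pf z - c ^ 2 * ρf z = k)
    (hcont : ∀ z, dt ρf z + ∑ i, dx i (fun w => ρf w * u w i) z = 0)
    (hmom : ∀ z, ∀ j : Fin d, ρf z * (dt (fun w => u w j) z
        + ∑ i, u z i * dx i (fun w => u w j) z) + dx j pf z = 0)
    (hdivub : ∀ z, ∑ i, dx i (fun w => ub w i) z = 0)
    (hpath : ∀ z, ∀ j : Fin d, dt (fun w => ub w j) z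
        + ∑ i, ub z i * dx i (fun w => ub w j) z = 0)
    (hperp : ∀ z, ∀ j : Fin d, ∑ i, u' z i * dx i (fun w => ub w j) z = 0)
    (hgrad : ∀ z, ∑ i, ∑ j, dx i (fun w => ub w j) z * dx j (fun w => ub w i) z = 0) :
    ∀ z, (1 / c ^ 2) * (dt (fun w => dt p' w + ∑ i, ub w i * dx i p' w) z
        + ∑ i, ub z i * dx i (fun w => dt p' w + ∑ j, ub w j * dx j p' w) z)
        - ∑ i, dx i (dx i p') z
      = ∑ i, ∑ j, dx i (fun w => dx j (fun v => ρf v * u' v i * u' v j) w) z := by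
  intro z
  let T : ℝ × (Fin d → ℝ) := (1, 0)
  let e : Fin d → ℝ × (Fin d → ℝ) := fun i => (0, Pi.single i 1)
  let U : Fin d → ℝ × (Fin d → ℝ) → ℝ := fun i w => ub w i
  let v : Fin d → ℝ × (Fin d → ℝ) → ℝ := fun i w => u' w i
  have hU (i : Fin d) : ContDiff ℝ (⊤ : ℕ∞) (U i) := contDiff_pi.1 hub i
  have hv (i : Fin d) : ContDiff ℝ (⊤ : ℕ∞) (v i) := contDiff_pi.1 hu'c i
  have hm (i : Fin d) : ContDiff ℝ (⊤ : ℕ∞) fun w => ρf w * v i w := hρ.mul (hv i)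
  have hu_apply (i : Fin d) : (fun w => u w i) = fun w => U i w + v i w :=
    funext fun w => congrFun (hsum w) i
  have hdiv (w) : ∑ i, dirDeriv (e i) (U i) w = 0 := hdivub w
  have hDρ (w) : convDeriv T e U ρf w = 1 / c ^ 2 * convDeriv T e U p' w := by
    have h : ρf = fun w => ρb + 1 / c ^ 2 * p' w := by
      funext w
      rw [hρdef]
      ring
    rw [h, convDeriv_add T e contDiff_const (contDiff_const.mul hp'), convDeriv_const,
      convDeriv_const_mul T e _ hp', zero_add]
  have hgradp (w) (j : Fin d) : dx j pf w = dirDeriv (e j) p' w := by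
    obtain ⟨k, hk⟩ := hpconst
    have h : pf = fun w => (k + c ^ 2 * ρb) + p' w := by
      funext w
      have := hk w
      rw [hρdef] at this
      field_simp at this
      linarith
    change dirDeriv (e j) pf w = _
    rw [h, dirDeriv_add _ contDiff_const hp', dirDeriv_const, zero_add]
  have hmass (w) : convDeriv T e U ρf w + ∑ i, dirDeriv (e i) (fun w => ρf w * v i w) w = 0 := by
    have h : dirDeriv T ρf w + ∑ i, dirDeriv (e i) (fun w => ρf w * u w i) w = 0 := hcont w
    have hs (i : Fin d) : dirDeriv (e i) (fun w => ρf w * u w i) w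
        = ρf w * dirDeriv (e i) (U i) w + U i w * dirDeriv (e i) ρf w
          + dirDeriv (e i) (fun w => ρf w * v i w) w := by
      have : (fun w => ρf w * u w i) = fun w => ρf w * U i w + ρf w * v i w := by
        funext w
        rw [congrFun (hu_apply i) w, mul_add]
      rw [this, dirDeriv_add _ (hρ.mul (hU i)) (hm i), dirDeriv_mul _ hρ (hU i)]
    simp only [hs, Finset.sum_add_distrib] at h
    rw [← Finset.mul_sum, hdiv] at h
    unfold convDeriv
    linarith
  have hmomv (w) (j : Fin d) : ρf w * (convDeriv T e U (v j) w
      + ∑ i, v i w * dirDeriv (e i) (v j) w) + dirDeriv (e j) p' w = 0 := by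
    have h : ρf w * (dirDeriv T (fun w => u w j) w
        + ∑ i, u w i * dirDeriv (e i) (fun w => u w j) w) + dx j pf w = 0 := hmom w j
    have h₁ : dirDeriv T (U j) w + ∑ i, U i w * dirDeriv (e i) (U j) w = 0 := hpath w j
    have h₂ : ∑ i, v i w * dirDeriv (e i) (U j) w = 0 := hperp w j
    have hui (i : Fin d) : u w i = U i w + v i w := congrFun (hu_apply i) w
    simp only [hu_apply, hui, dirDeriv_add _ (hU j) (hv j), hgradp, add_mul, mul_add,
      Finset.sum_add_distrib, h₂] at h
    unfold convDeriv
    linear_combination h - ρf w * h₁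
  have hmomcons (w) (j : Fin d) : convDeriv T e U (fun w => ρf w * v j w) w
      + ∑ i, dirDeriv (e i) (fun w => ρf w * v i w * v j w) w + dirDeriv (e j) p' w = 0 := by
    rw [convDeriv_mul T e hρ (hv j)]
    simp only [dirDeriv_mul _ (hm _) (hv j), Finset.sum_add_distrib]
    simp only [mul_assoc]
    rw [← Finset.mul_sum, ← Finset.mul_sum]
    linear_combination hmomv w j + v j w * hmass w
  have hperpm (w) (i : Fin d) : ∑ j, ρf w * v j w * dirDeriv (e j) (U i) w = 0 := by
    have h₂ : ∑ j, v j w * dirDeriv (e j) (U i) w = 0 := hperp w i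
    simp only [mul_assoc]
    rw [← Finset.mul_sum, h₂, mul_zero]
  have hmain := convDeriv_div_add_eq_zero T e hU hm (fun i j => (hm i).mul (hv j)) hp' hdiv
    hperpm hmomcons z
  have hdivm : (fun w => ∑ j, dirDeriv (e j) (fun w => ρf w * v j w) w)
      = fun w => -(1 / c ^ 2) * convDeriv T e U p' w := by
    funext w
    linear_combination hmass w - hDρ w
  rw [hdivm, convDeriv_const_mul T e _ (contDiff_convDeriv T e hU hp')] at hmain
  have hsymm : ∑ j, ∑ i, dirDeriv (e j) (dirDeriv (e i) fun w => ρf w * v i w * v j w) z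
      = ∑ i, ∑ j, dirDeriv (e i) (dirDeriv (e j) fun w => ρf w * v i w * v j w) z := by
    simp only [mul_right_comm]
  rw [hsymm] at hmain
  change 1 / c ^ 2 * convDeriv T e U (convDeriv T e U p') z
      - ∑ i, dirDeriv (e i) (dirDeriv (e i) p') z
    = ∑ i, ∑ j, dirDeriv (e i) (dirDeriv (e j) fun w => ρf w * v i w * v j w) z
  linear_combination -hmain
end

section
/- Let d ≥ 1, let ρ̄ > 0 and c > 0 be constants, let ū : ℝ × ℝ^d → ℝ^d be a smooth vector field with div ū = 0 everywhere, and let p' : ℝ × ℝ^d → ℝ and u' : ℝ × ℝ^d → ℝ^d be smooth solutions of the conservation laws ∂_t(p'/(ρ̄ c²)) + div((p'/(ρ̄ c²)) ū + u') = 0 and ∂_t(ρ̄ u'_j) + Σ_i ∂_{x_i}(ρ̄ u'_j ū_i + p' δ_{ij}) = 0 for j = 1, ..., d. Assume there is a compact set K ⊂ ℝ^d such that p'(t, ·) and u'(t, ·) vanish outside K for every t ∈ [0, τ]. Then for every t ∈ [0, τ], ∫_{ℝ^d} (1/2)( p'(t,x)²/c² + ρ̄² |u'(t,x)|² ) dx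 = ∫_{ℝ^d} (1/2)( p'(0,x)²/c² + ρ̄² |u'(0,x)|² ) dx. -/
open MeasureTheory

section EnergyIdentity

variable {d : ℕ}

/-- Pointwise energy balance in divergence form, in terms of the values of the derivatives. -/
lemma energy_balance (ρ c : ℝ) (hρ : ρ ≠ 0) (hc : c ≠ 0)
    (b : ℝ × (Fin d → ℝ) → Fin d → ℝ) (hb : Differentiable ℝ b)
    (hdiv : ∀ z, ∑ i, dx i (fun w => b w i) z = 0)
    (p : ℝ × (Fin d → ℝ) → ℝ) (u : ℝ × (Fin d → ℝ) → Fin d → ℝ)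
    (hp : Differentiable ℝ p) (hu : Differentiable ℝ u)
    (h1 : ∀ z, dt (fun w => p w / (ρ * c ^ 2)) z
        + ∑ i, dx i (fun w => p w / (ρ * c ^ 2) * b w i + u w i) z = 0)
    (h2 : ∀ z, ∀ j : Fin d, dt (fun w => ρ * u w j) z
        + ∑ i, dx i (fun w => ρ * u w j * b w i + (if i = j then p w else 0)) z = 0)
    (z : ℝ × (Fin d → ℝ)) :
    dt (fun w => (1 / 2) * ((p w) ^ 2 / c ^ 2 + ρ ^ 2 * ∑ k, (u w k) ^ 2)) z
      = -∑ i, dx i (fun w => (1 / 2) * ((p w) ^ 2 / c ^ 2 + ρ ^ 2 * ∑ k, (u w k) ^ 2) * b w i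
          + ρ * (p w * u w i)) z := by
  have hP : HasFDerivAt p (fderiv ℝ p z) z := (hp z).hasFDerivAt
  have hU : ∀ k, HasFDerivAt (fun w => u w k) (fderiv ℝ (fun w => u w k) z) z := fun k =>
    ((differentiable_pi.1 hu k) z).hasFDerivAt
  have hB : ∀ k, HasFDerivAt (fun w => b w k) (fderiv ℝ (fun w => b w k) z) z := fun k =>
    ((differentiable_pi.1 hb k) z).hasFDerivAt
  have hE := (((hP.pow 2).mul_const (c ^ 2)⁻¹).fun_add
    ((HasFDerivAt.fun_sum (u := Finset.univ) fun k _ => (hU k).pow 2).const_mul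
      (ρ ^ 2))).const_mul (1 / 2 : ℝ)
  have hM := hP.mul_const (ρ * c ^ 2)⁻¹
  have dM : ∀ v, fderiv ℝ (fun w => p w / (ρ * c ^ 2)) z v = fderiv ℝ p z v / (ρ * c ^ 2) :=
    fun v => by
      simp only [div_eq_mul_inv]
      rw [hM.fderiv]
      simp [mul_comm]
  have dN : ∀ i v, fderiv ℝ (fun w => p w / (ρ * c ^ 2) * b w i + u w i) z v
      = fderiv ℝ p z v / (ρ * c ^ 2) * b z i
        + p z / (ρ * c ^ 2) * fderiv ℝ (fun w => b w i) z v
        + fderiv ℝ (fun w => u w i) z v := fun i v => by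
    simp only [div_eq_mul_inv]
    rw [((hM.fun_mul (hB i)).fun_add (hU i)).fderiv]
    simp
    ring
  have dV : ∀ j v, fderiv ℝ (fun w => ρ * u w j) z v = ρ * fderiv ℝ (fun w => u w j) z v :=
    fun j v => by
      rw [((hU j).const_mul ρ).fderiv]
      simp
  have hQ : ∀ i j : Fin d, HasFDerivAt (fun w => if i = j then p w else 0)
      (if i = j then fderiv ℝ p z else 0) z := fun i j => by
    split_ifs
    · exact hP
    · exact hasFDerivAt_const _ _
  have dW : ∀ i j v, fderiv ℝ (fun w => ρ * u w j * b w i + (if i = j then p w else 0)) z v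
      = ρ * (fderiv ℝ (fun w => u w j) z v * b z i)
        + ρ * u z j * fderiv ℝ (fun w => b w i) z v
        + (if i = j then fderiv ℝ p z v else 0) := fun i j v => by
    rw [((((hU j).const_mul ρ).fun_mul (hB i)).fun_add (hQ i j)).fderiv]
    split_ifs <;> simp <;> ring
  have dE : ∀ v, fderiv ℝ (fun w => (1 / 2) * ((p w) ^ 2 / c ^ 2 + ρ ^ 2 * ∑ k, (u w k) ^ 2)) z v
      = p z * fderiv ℝ p z v / c ^ 2
        + ρ ^ 2 * ∑ k, u z k * fderiv ℝ (fun w => u w k) z v := fun v => by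
    simp only [div_eq_mul_inv] at hE ⊢
    rw [hE.fderiv]
    simp [mul_assoc, ← Finset.mul_sum]
    ring
  have dF : ∀ i v, fderiv ℝ (fun w => (1 / 2) * ((p w) ^ 2 / c ^ 2 + ρ ^ 2 * ∑ k, (u w k) ^ 2)
        * b w i + ρ * (p w * u w i)) z v
      = (p z * fderiv ℝ p z v / c ^ 2
          + ρ ^ 2 * ∑ k, u z k * fderiv ℝ (fun w => u w k) z v) * b z i
        + (1 / 2) * ((p z) ^ 2 / c ^ 2 + ρ ^ 2 * ∑ k, (u z k) ^ 2)
          * fderiv ℝ (fun w => b w i) z v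
        + ρ * (fderiv ℝ p z v * u z i + p z * fderiv ℝ (fun w => u w i) z v) := fun i v => by
    rw [← dE v]
    simp only [div_eq_mul_inv] at hE ⊢
    rw [((hE.differentiableAt.hasFDerivAt.fun_mul (hB i)).fun_add
      ((hP.fun_mul (hU i)).const_mul ρ)).fderiv]
    simp
    ring
  have e1 := h1 z
  have e2 := h2 z
  have e3 := hdiv z
  simp only [dt, dx, dM, dN, dV, dW, dE, dF] at e1 e2 e3 ⊢
  simp only [Finset.sum_add_distrib, ← Finset.mul_sum, Finset.sum_ite_eq', Finset.mem_univ,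
    if_true, e3, mul_zero, add_zero] at e1 e2 ⊢
  have s1 : ∀ r : ℝ, ∑ i, fderiv ℝ p z (0, Pi.single i 1) / r * b z i
      = (∑ i, fderiv ℝ p z (0, Pi.single i 1) * b z i) / r := fun r => by
    rw [Finset.sum_div]
    exact Finset.sum_congr rfl fun i _ => by ring
  have s2 : ∑ k, u z k * fderiv ℝ (fun w => u w k) z (1, 0)
      = -∑ k, u z k * ∑ i, fderiv ℝ (fun w => u w k) z (0, Pi.single i 1) * b z i
        - (∑ k, fderiv ℝ p z (0, Pi.single k 1) * u z k) / ρ := by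
    rw [Finset.sum_div, ← Finset.sum_neg_distrib, ← Finset.sum_sub_distrib]
    refine Finset.sum_congr rfl fun k _ => ?_
    have := e2 k
    field_simp
    linear_combination u z k * this
  have s3 : ∑ i, (p z * fderiv ℝ p z (0, Pi.single i 1) / c ^ 2
        + ρ ^ 2 * ∑ k, u z k * fderiv ℝ (fun w => u w k) z (0, Pi.single i 1)) * b z i
      = p z / c ^ 2 * ∑ i, fderiv ℝ p z (0, Pi.single i 1) * b z i
        + ρ ^ 2 * ∑ k, u z k * ∑ i, fderiv ℝ (fun w => u w k) z (0, Pi.single i 1) * b z i := by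
    simp only [add_mul, Finset.sum_add_distrib, Finset.mul_sum, Finset.sum_mul]
    rw [Finset.sum_comm (s := Finset.univ) (t := Finset.univ) (f := fun i k =>
      ρ ^ 2 * (u z k * fderiv ℝ (fun w => u w k) z (0, Pi.single i 1)) * b z i)]
    congr 1
    · exact Finset.sum_congr rfl fun i _ => by ring
    · exact Finset.sum_congr rfl fun k _ => Finset.sum_congr rfl fun i _ => by ring
  rw [s1] at e1
  rw [s2, s3]
  field_simp at e1 ⊢
  linear_combination p z * e1

/-- The integral of a directional derivative of a compactly supported `C¹` function vanishes. -/
lemma integral_fderiv_apply_eq_zero {E : Type*} [NormedAddCommGroup E] [NormedSpace ℝ E]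
    [FiniteDimensional ℝ E] [MeasurableSpace E] [BorelSpace E] (μ : Measure E)
    [μ.IsAddHaarMeasure] {f : E → ℝ}
    (hf : ContDiff ℝ 1 f) (hs : HasCompactSupport f) (v : E) :
    ∫ x, fderiv ℝ f x v ∂μ = 0 := by
  have hi : Integrable (fun x => fderiv ℝ f x v) μ :=
    ((hf.continuous_fderiv one_ne_zero).clm_apply continuous_const).integrable_of_hasCompactSupport
      (hs.fderiv_apply ℝ v)
  have := integral_mul_fderiv_eq_neg_fderiv_mul_of_integrable (μ := μ) (f := fun _ => (1 : ℝ))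
    (g := f) (v := v) (by simp) (by simpa using hi)
    (by simpa using hf.continuous.integrable_of_hasCompactSupport hs)
    (fun _ _ => differentiableAt_const _) (fun x _ => hf.differentiable one_ne_zero x)
  simpa using this

lemma dx_eq_fderiv_slice (i : Fin d) {f : ℝ × (Fin d → ℝ) → ℝ} (hf : Differentiable ℝ f)
    (t : ℝ) (x : Fin d → ℝ) :
    dx i f (t, x) = fderiv ℝ (fun y => f (t, y)) x (Pi.single i 1) := by
  have := ((hf (t, x)).hasFDerivAt.comp x (hasFDerivAt_prodMk_right t x)).fderiv
  simp only [Function.comp_def] at this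
  rw [this]
  simp [dx]

lemma hasDerivAt_dt {f : ℝ × (Fin d → ℝ) → ℝ} (hf : Differentiable ℝ f)
    (t : ℝ) (x : Fin d → ℝ) : HasDerivAt (fun s => f (s, x)) (dt f (t, x)) t := by
  have := ((hf (t, x)).hasFDerivAt.comp t (hasFDerivAt_prodMk_left t x)).hasDerivAt
  simpa [Function.comp_def, dt] using this

/-- A density obeying a conservation law with flux `F`, both supported in a fixed compact set,
has constant total mass. -/
lemma integral_eq_of_conservation_law {τ : ℝ} {e : ℝ × (Fin d → ℝ) → ℝ}
    {F : Fin d → ℝ × (Fin d → ℝ) → ℝ} (he : ContDiff ℝ 1 e) (hF : ∀ i, ContDiff ℝ 1 (F i))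
    (heF : ∀ z, dt e z = -∑ i, dx i (F i) z) {K : Set (Fin d → ℝ)} (hK : IsCompact K)
    (he0 : ∀ t ∈ Set.Icc (0 : ℝ) τ, ∀ x ∉ K, e (t, x) = 0)
    (hF0 : ∀ i, ∀ t ∈ Set.Icc (0 : ℝ) τ, ∀ x ∉ K, F i (t, x) = 0)
    {t : ℝ} (ht : t ∈ Set.Icc (0 : ℝ) τ) :
    ∫ x, e (t, x) = ∫ x, e (0, x) := by
  have hed := he.differentiable one_ne_zero
  have hcont : Continuous (dt e) :=
    (he.continuous_fderiv one_ne_zero).clm_apply continuous_const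
  have h0 : (0 : ℝ) ∈ Set.Icc (0 : ℝ) τ := ⟨le_rfl, ht.1.trans ht.2⟩
  have hint : ∀ s ∈ Set.Icc (0 : ℝ) τ, Integrable (fun x => e (s, x)) := fun s hs =>
    (he.continuous.comp (Continuous.prodMk_right s)).integrable_of_hasCompactSupport
      (HasCompactSupport.intro hK (he0 s hs))
  have hsupp : ∀ i, ∀ s ∈ Set.Icc (0 : ℝ) τ, HasCompactSupport (fun x => F i (s, x)) :=
    fun i s hs => HasCompactSupport.intro hK (hF0 i s hs)
  have hslice : ∀ i s, ContDiff ℝ 1 (fun x => F i (s, x)) := fun i s =>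
    (hF i).comp (contDiff_prodMk_right s)
  have hdx : ∀ i s x, dx i (F i) (s, x) = fderiv ℝ (fun y => F i (s, y)) x (Pi.single i 1) :=
    fun i s x => dx_eq_fderiv_slice i ((hF i).differentiable one_ne_zero) s x
  have hzero : ∀ s ∈ Set.Icc (0 : ℝ) τ, ∫ x, dt e (s, x) = 0 := fun s hs => by
    simp only [heF, hdx, integral_neg]
    rw [integral_finsetSum]
    · simp [integral_fderiv_apply_eq_zero volume (hslice _ s) (hsupp _ s hs)]
    · exact fun i _ => (((hslice i s).continuous_fderiv one_ne_zero).clm_apply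
        continuous_const).integrable_of_hasCompactSupport ((hsupp i s hs).fderiv_apply ℝ _)
  have hvanish : ∀ s ∈ Set.Icc (0 : ℝ) τ, ∀ x ∉ K, dt e (s, x) = 0 := fun s hs x hx => by
    rw [heF, Finset.sum_eq_zero, neg_zero]
    intro i _
    have : (fun y => F i (s, y)) =ᶠ[nhds x] fun _ => 0 := by
      filter_upwards [hK.isClosed.isOpen_compl.mem_nhds hx] with y hy using hF0 i s hs y hy
    rw [hdx, this.fderiv_eq]
    simp
  have hsub : Set.uIcc 0 t ⊆ Set.Icc 0 τ := by
    rw [Set.uIcc_of_le ht.1]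
    exact Set.Icc_subset_Icc_right ht.2
  have hftc : ∀ x, e (t, x) - e (0, x) = ∫ s in (0 : ℝ)..t, dt e (s, x) := fun x =>
    (intervalIntegral.integral_eq_sub_of_hasDerivAt (fun s _ => hasDerivAt_dt hed s x)
      ((hcont.comp (Continuous.prodMk_left x)).intervalIntegrable 0 t)).symm
  rw [← sub_eq_zero, ← integral_sub (hint t ht) (hint 0 h0),
    ← setIntegral_eq_integral_of_forall_compl_eq_zero (s := K)
      (fun x hx => by rw [he0 t ht x hx, he0 0 h0 x hx, sub_zero])]
  simp only [hftc, intervalIntegral.integral_of_le ht.1]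
  rw [integral_integral_swap]
  · rw [← intervalIntegral.integral_of_le ht.1]
    refine intervalIntegral.integral_zero_ae (.of_forall fun s hs => ?_)
    have hs' := hsub (Set.uIoc_subset_uIcc hs)
    rw [setIntegral_eq_integral_of_forall_compl_eq_zero (hvanish s hs')]
    exact hzero s hs'
  · rw [Measure.prod_restrict]
    exact ((hcont.comp continuous_swap).continuousOn.integrableOn_compact
      (hK.prod isCompact_Icc)).mono_set (Set.prod_mono_right Set.Ioc_subset_Icc_self)

end EnergyIdentity

/-- energy identity. Under the two linearized conservation laws with a
smooth divergence-free `ū`, if `p'(t,·)` and `u'(t,·)` vanish outside a compact set `K`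
for all `t ∈ [0, τ]`, then the total energy
`∫ (1/2)(p'²/c² + ρ̄²|u'|²) dx` at time `t` equals its value at time `0`, for all
`t ∈ [0, τ]`. -/
theorem stmt15 (d : ℕ) (hd : 1 ≤ d) (ρb c : ℝ) (hρ : 0 < ρb) (hc : 0 < c) (τ : ℝ)
    (ub : ℝ × (Fin d → ℝ) → Fin d → ℝ) (hub : ContDiff ℝ (⊤ : ℕ∞) ub)
    (hdivub : ∀ z, ∑ i, dx i (fun w => ub w i) z = 0)
    (p' : ℝ × (Fin d → ℝ) → ℝ) (u' : ℝ × (Fin d → ℝ) → Fin d → ℝ)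
    (hp : ContDiff ℝ (⊤ : ℕ∞) p') (hu : ContDiff ℝ (⊤ : ℕ∞) u')
    (h1 : ∀ z, dt (fun w => p' w / (ρb * c ^ 2)) z
        + ∑ i, dx i (fun w => p' w / (ρb * c ^ 2) * ub w i + u' w i) z = 0)
    (h2 : ∀ z, ∀ j : Fin d, dt (fun w => ρb * u' w j) z
        + ∑ i, dx i (fun w => ρb * u' w j * ub w i + (if i = j then p' w else 0)) z = 0)
    (K : Set (Fin d → ℝ)) (hK : IsCompact K)
    (hsupp : ∀ t ∈ Set.Icc (0 : ℝ) τ, ∀ x ∉ K, p' (t, x) = 0 ∧ u' (t, x) = 0) :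
    ∀ t ∈ Set.Icc (0 : ℝ) τ,
      (∫ x : Fin d → ℝ,
        (1 / 2) * ((p' (t, x)) ^ 2 / c ^ 2 + ρb ^ 2 * ∑ k, (u' (t, x) k) ^ 2))
      = ∫ x : Fin d → ℝ,
        (1 / 2) * ((p' (0, x)) ^ 2 / c ^ 2 + ρb ^ 2 * ∑ k, (u' (0, x) k) ^ 2) := by
  intro t ht
  have hp1 : ContDiff ℝ 1 p' := hp.of_le (by exact_mod_cast le_top)
  have hu1 : ContDiff ℝ 1 u' := hu.of_le (by exact_mod_cast le_top)
  have hb1 : ContDiff ℝ 1 ub := hub.of_le (by exact_mod_cast le_top)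
  have he : ContDiff ℝ 1
      (fun w => (1 / 2) * ((p' w) ^ 2 / c ^ 2 + ρb ^ 2 * ∑ k, (u' w k) ^ 2)) := by
    fun_prop
  refine integral_eq_of_conservation_law he (fun i => ?_)
    (energy_balance ρb c hρ.ne' hc.ne' ub (hb1.differentiable one_ne_zero) hdivub p' u'
      (hp1.differentiable one_ne_zero) (hu1.differentiable one_ne_zero) h1 h2) hK ?_ ?_ ht
  · fun_prop
  · intro s hs x hx
    simp [hsupp s hs x hx]
  · intro i s hs x hx
    simp [hsupp s hs x hx]
end

section
/- Let d ≥ 1, let ρ̄ > 0 and c > 0 be constants, let ū : ℝ × ℝ^d → ℝ^d be a smooth vector field with div ū = 0 everywhere, and let p' : ℝ × ℝ^d → ℝ and u' : ℝ × ℝ^d → ℝ^d be smooth solutions at every point of the conservation laws ∂_t(p'/(ρ̄ c²)) + div((p'/(ρ̄ c²)) ū + u') = 0 and ∂_t(ρ̄ u'_j) + Σ_i ∂_{x_i}(ρ̄ u'_j ū_i + p' δ_{ij}) = 0 for j = 1, ..., d. Define the perturbed energy E = (1/2)( p'²/(ρ̄ c²) + ρ̄ |u'|² ). Then ∂_t E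 + div( E ū + p' u' ) = 0 holds at every point. -/
/-- The derivative of the energy density `(1 / 2) * (p ^ 2 / K + ρ * |u| ^ 2)`. -/
theorem hasFDerivAt_energy {X : Type*} [NormedAddCommGroup X] [NormedSpace ℝ X] {d : ℕ}
    {p : X → ℝ} {u : X → Fin d → ℝ} {P : X →L[ℝ] ℝ} {U : Fin d → X →L[ℝ] ℝ} {z : X} (ρ K : ℝ)
    (hp : HasFDerivAt p P z) (hu : ∀ k, HasFDerivAt (fun w => u w k) (U k) z) :
    HasFDerivAt (fun w => (1 / 2) * ((p w) ^ 2 / K + ρ * ∑ k, (u w k) ^ 2))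
      ((p z / K) • P + ρ • ∑ k, u z k • U k) z := by
  have hs : HasFDerivAt (fun w => ∑ k, (u w k) ^ 2) (∑ k, (2 * u z k) • U k) z :=
    HasFDerivAt.fun_sum fun k _ => by simpa using (hu k).pow 2
  have hE := ((((hp.pow 2).mul_const K⁻¹).add (hs.const_mul ρ)).const_mul (1 / 2))
  refine (hE.congr_fderiv ?_).congr_of_eventuallyEq (.of_forall fun w => ?_)
  · ext v
    have h2 : ∑ k, 2 * u z k * U k v = 2 * ∑ k, u z k * U k v := by
      rw [Finset.mul_sum]
      exact Finset.sum_congr rfl fun k _ => by ring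
    simp [h2]
    ring
  · simp [div_eq_mul_inv]

/-- Multiplying the mass equation by `p` and the momentum equation by `u` and summing gives the
energy equation, at the level of the pointwise values of the derivatives. -/
theorem energy_balance_s19 {d : ℕ} {ρ K p Pt : ℝ} {u b P Ut : Fin d → ℝ} {U B : Fin d → Fin d → ℝ}
    (hdiv : ∑ i, B i i = 0)
    (h1 : Pt / K + ∑ i, (p / K * B i i + b i * (P i / K) + U i i) = 0)
    (h2 : ∀ j, ρ * Ut j
      + ∑ i, (ρ * u j * B i i + b i * (ρ * U j i) + if i = j then P i else 0) = 0) (E : ℝ) :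
    p / K * Pt + ρ * ∑ k, u k * Ut k
      + ∑ i, (E * B i i + b i * (p / K * P i + ρ * ∑ k, u k * U k i)
        + (p * U i i + u i * P i)) = 0 := by
  simp only [Finset.sum_add_distrib, ← Finset.mul_sum, hdiv, Finset.sum_ite_eq',
    Finset.mem_univ, if_true, mul_zero, zero_add] at h1 h2 ⊢
  have h3 : ∑ j, u j * (ρ * Ut j + (∑ i, b i * (ρ * U j i) + P j)) = 0 :=
    Finset.sum_eq_zero fun j _ => by rw [h2 j, mul_zero]
  have h4 : ∑ i, b i * (p / K * P i + ρ * ∑ k, u k * U k i)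
      = p * ∑ i, b i * (P i / K) + ∑ j, u j * ∑ i, b i * (ρ * U j i) := by
    simp only [mul_add, Finset.sum_add_distrib, Finset.mul_sum]
    congr 1
    · exact Finset.sum_congr rfl fun i _ => by ring
    · rw [Finset.sum_comm]
      exact Finset.sum_congr rfl fun i _ => Finset.sum_congr rfl fun j _ => by ring
  have h5 : ρ * ∑ k, u k * Ut k = ∑ k, u k * (ρ * Ut k) := by
    rw [Finset.mul_sum]
    exact Finset.sum_congr rfl fun k _ => by ring
  simp only [mul_add, Finset.sum_add_distrib] at h3
  rw [h4, h5]
  linear_combination p * h1 + h3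

/-- with constants `ρ̄, c > 0`, a smooth divergence-free `ū`, and smooth
`p', u'` solving the two linearized conservation laws, the perturbed energy
`E = (1/2)(p'²/(ρ̄ c²) + ρ̄ |u'|²)` satisfies `∂_t E + div(E ū + p' u') = 0`. -/
theorem stmt19 (d : ℕ) (hd : 1 ≤ d) (ρb c : ℝ) (hρ : 0 < ρb) (hc : 0 < c)
    (ub : ℝ × (Fin d → ℝ) → Fin d → ℝ) (hub : ContDiff ℝ (⊤ : ℕ∞) ub)
    (hdivub : ∀ z, ∑ i, dx i (fun w => ub w i) z = 0)
    (p' : ℝ × (Fin d → ℝ) → ℝ) (u' : ℝ × (Fin d → ℝ) → Fin d → ℝ)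
    (hp : ContDiff ℝ (⊤ : ℕ∞) p') (hu : ContDiff ℝ (⊤ : ℕ∞) u')
    (h1 : ∀ z, dt (fun w => p' w / (ρb * c ^ 2)) z
        + ∑ i, dx i (fun w => p' w / (ρb * c ^ 2) * ub w i + u' w i) z = 0)
    (h2 : ∀ z, ∀ j : Fin d, dt (fun w => ρb * u' w j) z
        + ∑ i, dx i (fun w => ρb * u' w j * ub w i + (if i = j then p' w else 0)) z = 0) :
    ∀ z, dt (fun w => (1 / 2) * ((p' w) ^ 2 / (ρb * c ^ 2) + ρb * ∑ k, (u' w k) ^ 2)) z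
        + ∑ i, dx i (fun w =>
            (1 / 2) * ((p' w) ^ 2 / (ρb * c ^ 2) + ρb * ∑ k, (u' w k) ^ 2) * ub w i
            + p' w * u' w i) z = 0 := by
  intro z
  have hP : HasFDerivAt p' (fderiv ℝ p' z) z := (hp.differentiable (by simp) z).hasFDerivAt
  have hU (k : Fin d) : HasFDerivAt (fun w => u' w k) (fderiv ℝ (fun w => u' w k) z) z :=
    (differentiableAt_pi.1 (hu.differentiable (by simp) z) k).hasFDerivAt
  have hB (k : Fin d) : HasFDerivAt (fun w => ub w k) (fderiv ℝ (fun w => ub w k) z) z :=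
    (differentiableAt_pi.1 (hub.differentiable (by simp) z) k).hasFDerivAt
  have hPK : HasFDerivAt (fun w => p' w / (ρb * c ^ 2))
      ((ρb * c ^ 2)⁻¹ • fderiv ℝ p' z) z := by
    simpa only [div_eq_mul_inv] using hP.mul_const (ρb * c ^ 2)⁻¹
  have hE := hasFDerivAt_energy ρb (ρb * c ^ 2) hP hU
  have hI (i j : Fin d) : HasFDerivAt (fun w => if i = j then p' w else 0)
      (if i = j then fderiv ℝ p' z else 0) z := by
    split_ifs
    · exact hP
    · exact hasFDerivAt_const 0 z
  have hmass (i : Fin d) := (((hPK.fun_mul (hB i)).fun_add (hU i)).fderiv)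
  have hmom (i j : Fin d) := ((((hU j).const_mul ρb).fun_mul (hB i)).fun_add (hI i j)).fderiv
  have hen (i : Fin d) := ((hE.fun_mul (hB i)).fun_add (hP.fun_mul (hU i))).fderiv
  have e0 := hdivub z
  have e1 := h1 z
  have e2 := h2 z
  simp only [dt, dx] at e0 e1 e2 ⊢
  simp only [hmass, hPK.fderiv] at e1
  simp only [hmom, fun j => ((hU j).const_mul ρb).fderiv] at e2
  simp only [hen, hE.fderiv]
  simp only [add_apply, smul_apply, sum_apply, smul_eq_mul] at e1 e2 ⊢
  refine energy_balance_s19 (P := fun i => fderiv ℝ p' z (0, Pi.single i 1))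
    (B := fun i j => fderiv ℝ (fun w => ub w i) z (0, Pi.single j 1))
    (U := fun i j => fderiv ℝ (fun w => u' w i) z (0, Pi.single j 1)) e0 ?_ (fun j => ?_) _
  · simpa only [div_eq_inv_mul] using e1
  · refine Eq.trans ?_ (e2 j)
    congr 1
    refine Finset.sum_congr rfl fun i _ => ?_
    split_ifs <;> rfl
end
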